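/- arXiv:2002.04593 — 9 statements merged into one kernel-verified Lean document; each statement's English description precedes it below -/
import Mathlib

section
/- Let L be the K-algebra presented by generators e_v, e_w, C, Cs, D, Ds subject to the relations e_v*e_v = e_v, e_w*e_w = e_w, e_v*e_w = 0, e_w*e_v = 0, e_v + e_w = 1, e_v*C = C, C*e_v = C, e_v*D = D, D*e_w = D, e_v*Cs = Cs, Cs*e_v = Cs, e_w*Ds = Ds, Ds*e_v = Ds, Cs*C = e_v, Ds*D = e_w, Cs*D = 0, Ds*C = 0, C*Cs + D*Ds = e_v (this is the Leavitt path algebra of the Toeplitz graph, realizable in Lean as a RingQuot of FreeAlgebra K (Fin 6) by these relations). Then there is a K-algebra isomorphism φ : R → L satisfying φ(X) = Cs + Ds and φ(Y) = C + D. -/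
noncomputable section

/-- The defining relation `X * Y = 1` of the Jacobson algebra. -/
inductive JRel (K : Type*) [Field K] : FreeAlgebra K (Fin 2) → FreeAlgebra K (Fin 2) → Prop
  | rel : JRel K (FreeAlgebra.ι K 0 * FreeAlgebra.ι K 1) 1

/-- The Jacobson algebra `K⟨X, Y | XY = 1⟩`. -/
abbrev Jacobson (K : Type*) [Field K] := RingQuot (JRel K)

section ToeplitzGenerators

variable (K : Type*) [Field K]

/-- The generator `X` of the Jacobson algebra. -/
def Xg : Jacobson K := RingQuot.mkAlgHom K (JRel K) (FreeAlgebra.ι K 0)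

/-- The generator `Y` of the Jacobson algebra. -/
def Yg : Jacobson K := RingQuot.mkAlgHom K (JRel K) (FreeAlgebra.ι K 1)

/-- Abbreviations for the six generators of the Leavitt path algebra of the Toeplitz graph:
`0 = e_v`, `1 = e_w`, `2 = C`, `3 = Cs`, `4 = D`, `5 = Ds`. -/
abbrev tg (i : Fin 6) : FreeAlgebra K (Fin 6) := FreeAlgebra.ι K i

/-- The defining relations of the Leavitt path algebra of the Toeplitz graph, with the
generators `e_v = tg 0`, `e_w = tg 1`, `C = tg 2`, `Cs = tg 3`, `D = tg 4`, `Ds = tg 5`. -/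
inductive TRel : FreeAlgebra K (Fin 6) → FreeAlgebra K (Fin 6) → Prop
  | vv : TRel (tg K 0 * tg K 0) (tg K 0)
  | ww : TRel (tg K 1 * tg K 1) (tg K 1)
  | vw : TRel (tg K 0 * tg K 1) 0
  | wv : TRel (tg K 1 * tg K 0) 0
  | sum_idem : TRel (tg K 0 + tg K 1) 1
  | vC : TRel (tg K 0 * tg K 2) (tg K 2)
  | Cv : TRel (tg K 2 * tg K 0) (tg K 2)
  | vD : TRel (tg K 0 * tg K 4) (tg K 4)
  | Dw : TRel (tg K 4 * tg K 1) (tg K 4)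
  | vCs : TRel (tg K 0 * tg K 3) (tg K 3)
  | Csv : TRel (tg K 3 * tg K 0) (tg K 3)
  | wDs : TRel (tg K 1 * tg K 5) (tg K 5)
  | Dsv : TRel (tg K 5 * tg K 0) (tg K 5)
  | CsC : TRel (tg K 3 * tg K 2) (tg K 0)
  | DsD : TRel (tg K 5 * tg K 4) (tg K 1)
  | CsD : TRel (tg K 3 * tg K 4) 0
  | DsC : TRel (tg K 5 * tg K 2) 0
  | CK : TRel (tg K 2 * tg K 3 + tg K 4 * tg K 5) (tg K 0)

/-- The Leavitt path algebra of the Toeplitz graph, presented by generators and relations. -/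
abbrev Toeplitz := RingQuot (TRel K)

/-- The image of a generator in the Leavitt path algebra of the Toeplitz graph. -/
def tgen (i : Fin 6) : Toeplitz K := RingQuot.mkAlgHom K (TRel K) (tg K i)

end ToeplitzGenerators

variable (K : Type*) [Field K]

/-- Images of the six generators in a ring with elements `x`, `y`. -/
def tImg {A : Type*} [Ring A] (x y : A) : Fin 6 → A :=
  ![y * x, 1 - y * x, y * (y * x), y * (x * x), y * (1 - y * x), (1 - y * x) * x]

/-- The map from the Leavitt path algebra given by `x * y = 1`. -/
def tLift {A : Type*} [Ring A] [Algebra K A] (x y : A) (h : x * y = 1) : Toeplitz K →ₐ[K] A :=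
  RingQuot.liftAlgHom K ⟨FreeAlgebra.lift K (tImg x y), by
    have h2 : ∀ z, x * (y * z) = z := fun z => by rw [← mul_assoc, h, one_mul]
    intro a b r
    cases r <;> simp [tImg, mul_sub, sub_mul, mul_assoc, h, h2]⟩

theorem tLift_tgen {A : Type*} [Ring A] [Algebra K A] (x y : A) (h : x * y = 1) (i : Fin 6) :
    tLift K x y h (tgen K i) = tImg x y i := by
  simp [tLift, tgen, tg]

/-- The map from the Jacobson algebra given by `x * y = 1`. -/
def jLift {A : Type*} [Ring A] [Algebra K A] (x y : A) (h : x * y = 1) : Jacobson K →ₐ[K] A :=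
  RingQuot.liftAlgHom K ⟨FreeAlgebra.lift K ![x, y], by
    intro a b r
    cases r
    simp [h]⟩

theorem jLift_X {A : Type*} [Ring A] [Algebra K A] (x y : A) (h : x * y = 1) :
    jLift K x y h (Xg K) = x := by
  simp [jLift, Xg]

theorem jLift_Y {A : Type*} [Ring A] [Algebra K A] (x y : A) (h : x * y = 1) :
    jLift K x y h (Yg K) = y := by
  simp [jLift, Yg]

theorem XY_one : Xg K * Yg K = 1 := by
  have := RingQuot.mkAlgHom_rel K (JRel.rel (K := K))
  simpa [Xg, Yg] using this

theorem tImg_tgen : tImg (tgen K 3 + tgen K 5) (tgen K 2 + tgen K 4) = tgen K ∧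
    (tgen K 3 + tgen K 5) * (tgen K 2 + tgen K 4) = 1 := by
  have rel : ∀ {a b}, TRel K a b → RingQuot.mkAlgHom K (TRel K) a = RingQuot.mkAlgHom K (TRel K) b :=
    fun r => RingQuot.mkAlgHom_rel K r
  have vw := rel .vw
  have wv := rel .wv
  have s := rel .sum_idem
  have Cv := rel .Cv
  have vCs := rel .vCs
  have wDs := rel .wDs
  have Dw := rel .Dw
  have CsC := rel .CsC
  have DsD := rel .DsD
  have CsD := rel .CsD
  have DsC := rel .DsC
  have CK := rel .CK
  simp only [map_mul, map_add, map_one, map_zero] at *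
  change tgen K 0 * tgen K 1 = 0 at vw
  change tgen K 1 * tgen K 0 = 0 at wv
  change tgen K 0 + tgen K 1 = 1 at s
  change tgen K 2 * tgen K 0 = tgen K 2 at Cv
  change tgen K 0 * tgen K 3 = tgen K 3 at vCs
  change tgen K 1 * tgen K 5 = tgen K 5 at wDs
  change tgen K 4 * tgen K 1 = tgen K 4 at Dw
  change tgen K 3 * tgen K 2 = tgen K 0 at CsC
  change tgen K 5 * tgen K 4 = tgen K 1 at DsD
  change tgen K 3 * tgen K 4 = 0 at CsD
  change tgen K 5 * tgen K 2 = 0 at DsC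
  change tgen K 2 * tgen K 3 + tgen K 4 * tgen K 5 = tgen K 0 at CK
  generalize tgen K = g at *
  have CDs : g 2 * g 5 = 0 := by
    rw [← Cv, ← wDs, mul_assoc, ← mul_assoc (g 0), vw, zero_mul, mul_zero]
  have DCs : g 4 * g 3 = 0 := by
    rw [← Dw, ← vCs, mul_assoc, ← mul_assoc (g 1), wv, zero_mul, mul_zero]
  have Dv : g 4 * g 0 = 0 := by rw [← Dw, mul_assoc, wv, mul_zero]
  have Cw : g 2 * g 1 = 0 := by rw [← Cv, mul_assoc, vw, mul_zero]
  have vDs : g 0 * g 5 = 0 := by rw [← wDs, ← mul_assoc, vw, zero_mul]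
  have wCs : g 1 * g 3 = 0 := by rw [← vCs, ← mul_assoc, wv, zero_mul]
  have yx : (g 2 + g 4) * (g 3 + g 5) = g 0 := by
    rw [add_mul, mul_add, mul_add, CDs, DCs, add_zero, zero_add, CK]
  have w : 1 - g 0 = g 1 := by rw [← s]; abel
  refine ⟨?_, by rw [add_mul, mul_add, mul_add, CsC, CsD, DsC, DsD, add_zero, zero_add, s]⟩
  funext i
  fin_cases i
  · exact yx
  · simp [tImg, yx, w]
  · simp [tImg, yx, add_mul, Cv, Dv]
  · simp [tImg, ← mul_assoc, yx, mul_add, vCs, vDs]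
  · simp [tImg, yx, w, add_mul, Cw, Dw]
  · simp [tImg, yx, w, mul_add, wCs, wDs]

/-- The Jacobson algebra is isomorphic, as a `K`-algebra, to the Leavitt path algebra of the
Toeplitz graph, via an isomorphism sending `X` to `c* + d*` and `Y` to `c + d`. -/
theorem jacobson_iso_leavitt_toeplitz :
    ∃ φ : Jacobson K ≃ₐ[K] Toeplitz K,
      φ (Xg K) = tgen K 3 + tgen K 5 ∧ φ (Yg K) = tgen K 2 + tgen K 4 := by
  obtain ⟨h1, h2⟩ := tImg_tgen K
  have hXY := XY_one K
  have hx : (tImg (Xg K) (Yg K)) 3 + (tImg (Xg K) (Yg K)) 5 = Xg K := by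
    simp [tImg, sub_mul, mul_assoc]
  have hy : (tImg (Xg K) (Yg K)) 2 + (tImg (Xg K) (Yg K)) 4 = Yg K := by
    simp [tImg, mul_sub]
  refine ⟨AlgEquiv.ofAlgHom (jLift K _ _ h2) (tLift K _ _ hXY) ?_ ?_,
    jLift_X K _ _ h2, jLift_Y K _ _ h2⟩
  · apply RingQuot.ringQuot_ext'
    apply FreeAlgebra.hom_ext
    funext i
    change jLift K _ _ h2 (tLift K _ _ hXY (tgen K i)) = tgen K i
    rw [tLift_tgen]
    conv_rhs => rw [← h1]
    fin_cases i <;> simp [tImg, jLift_X, jLift_Y]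
  · apply RingQuot.ringQuot_ext'
    apply FreeAlgebra.hom_ext
    funext i
    fin_cases i
    · change tLift K _ _ hXY (jLift K _ _ h2 (Xg K)) = Xg K
      rw [jLift_X, map_add, tLift_tgen, tLift_tgen, hx]
    · change tLift K _ _ hXY (jLift K _ _ h2 (Yg K)) = Yg K
      rw [jLift_Y, map_add, tLift_tgen, tLift_tgen, hy]
end
end

section
/- In the Jacobson algebra R one has Y*X ≠ 1; in particular, R is not directly finite (X is right-invertible but not left-invertible). -/
noncomputable section

variable (K : Type*) [Field K]

/-- The left shift on sequences. -/
def shiftL : Module.End K (ℕ → K) where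
  toFun f := fun n => f (n + 1)
  map_add' _ _ := rfl
  map_smul' _ _ := rfl

/-- The right shift on sequences. -/
def shiftR : Module.End K (ℕ → K) where
  toFun f := fun n => Nat.casesOn n 0 (fun m => f m)
  map_add' f g := by
    funext n
    cases n <;> simp
  map_smul' c f := by
    funext n
    cases n <;> simp

theorem shiftL_mul_shiftR : shiftL K * shiftR K = 1 := by
  ext1
  rfl

/-- The representation of the Jacobson algebra on sequences by shifts. -/
def shiftRep : Jacobson K →ₐ[K] Module.End K (ℕ → K) :=
  RingQuot.liftAlgHom K ⟨FreeAlgebra.lift K ![shiftL K, shiftR K], by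
    intro a b h
    cases h
    simpa using shiftL_mul_shiftR K⟩

theorem shiftRep_X : shiftRep K (Xg K) = shiftL K := by
  simp [shiftRep, Xg]

theorem shiftRep_Y : shiftRep K (Yg K) = shiftR K := by
  simp [shiftRep, Yg]

/-- In the Jacobson algebra one has `Y * X ≠ 1`; in particular the Jacobson algebra is not
directly finite (`X` is right-invertible but not left-invertible). -/
theorem jacobson_not_directly_finite : Yg K * Xg K ≠ 1 := by
  intro h
  have h1 := congrArg (shiftRep K) h
  rw [map_mul, map_one, shiftRep_X, shiftRep_Y] at h1
  have h2 : (0 : K) = 1 := congrFun (LinearMap.congr_fun h1 (fun _ => (1 : K))) 0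
  exact zero_ne_one h2
end
end

section
/- The Jacobson algebra R is left hereditary: every left ideal of R (i.e. every R-submodule I of R) is a projective left R-module. -/
noncomputable section

variable (K : Type*) [Field K]


open scoped TensorProduct

/-- A `k`-linear map `M → N` into an `R`-module extends `R`-linearly to `R ⊗ M`. -/
theorem exists_extend {k R M N : Type*} [Field k] [Ring R] [Algebra k R]
    [AddCommGroup M] [Module k M] [AddCommGroup N] [Module k N] [Module R N]
    [IsScalarTower k R N] (δ : M →ₗ[k] N) :
    ∃ G : R ⊗[k] M →ₗ[R] N, ∀ r m, G (r ⊗ₜ m) = r • δ m :=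
  ⟨TensorProduct.AlgebraTensorModule.lift (LinearMap.toSpanSingleton R (M →ₗ[k] N) δ),
    fun r m => by simp⟩

/-- The abstract argument: if `R` is generated by `x, y` with `x * y = 1`, and is universal for
this relation, then every left ideal is projective. -/
theorem hereditary_aux {k : Type*} {R : Type*} [Field k] [Ring R] [Algebra k R] (x y : R)
    (hxy : x * y = 1)
    (ind : ∀ P : R → Prop, (∀ c : k, P (algebraMap k R c)) → P x → P y →
      (∀ a b, P a → P b → P (a + b)) → (∀ a b, P a → P b → P (a * b)) → ∀ a, P a)
    (I : Submodule R R)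
    (hlift : ∀ a b : Module.End k (((R ⊗[k] (R ⧸ I)) × (R ⊗[k] (R ⧸ I))) × (R ⧸ I)),
      a * b = 1 → ∃ φ : R →ₐ[k] Module.End k
        (((R ⊗[k] (R ⧸ I)) × (R ⊗[k] (R ⧸ I))) × (R ⧸ I)), φ x = a ∧ φ y = b) :
    Module.Projective R I := by
  -- a `k`-linear section of the quotient map
  obtain ⟨t, ht⟩ := (I.mkQ.restrictScalars k).exists_rightInverse_of_surjective
    (LinearMap.range_eq_top.2 I.mkQ_surjective)
  have ht' : ∀ m, I.mkQ (t m) = m := fun m => LinearMap.congr_fun ht m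
  have hmem : ∀ r, I.mkQ r = 0 → r ∈ I := fun r hr => (Submodule.Quotient.mk_eq_zero I).1 hr
  have hxy2 : ∀ r, x * (y * r) = r := fun r => by rw [← mul_assoc, hxy, one_mul]
  have hδ : ∀ (z : R) (m : R ⧸ I), z * t m - t (z • m) ∈ I := by
    intro z m
    apply hmem
    rw [map_sub, ht', ← smul_eq_mul, map_smul, ht',
      sub_self]
  let δ : R → (R ⧸ I →ₗ[k] I) := fun z =>
    { toFun := fun m => ⟨z * t m - t (z • m), hδ z m⟩
      map_add' := fun m n => by
        ext; simp [mul_add]; abel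
      map_smul' := fun c m => by
        ext
        simp [smul_comm z c m, smul_sub] }
  obtain ⟨G1, hG1⟩ := exists_extend (R := R) (δ x)
  obtain ⟨G2, hG2⟩ := exists_extend (R := R) (δ y)
  let ι : R → (R ⧸ I →ₗ[k] R ⊗[k] (R ⧸ I)) := fun r => TensorProduct.mk k R (R ⧸ I) r
  let L : R → ((R ⧸ I) →ₗ[k] (R ⧸ I)) := fun r => Algebra.lsmul k k (R ⧸ I) r
  let LS : R → ((R ⊗[k] (R ⧸ I)) × (R ⊗[k] (R ⧸ I)) →ₗ[k] (R ⊗[k] (R ⧸ I)) × (R ⊗[k] (R ⧸ I))) := fun r => Algebra.lsmul k k ((R ⊗[k] (R ⧸ I)) × (R ⊗[k] (R ⧸ I))) r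
  let DX : (R ⧸ I) →ₗ[k] (R ⊗[k] (R ⧸ I)) × (R ⊗[k] (R ⧸ I)) := (ι 1).prod 0
  let DY : (R ⧸ I) →ₗ[k] (R ⊗[k] (R ⧸ I)) × (R ⊗[k] (R ⧸ I)) := (-((ι y).comp (L y))).prod (ι 1 - ι (y * x))
  let A : Module.End k (((R ⊗[k] (R ⧸ I)) × (R ⊗[k] (R ⧸ I))) × (R ⧸ I)) :=
    ((LS x).coprod DX).prod ((L x).comp (LinearMap.snd k _ _))
  let B : Module.End k (((R ⊗[k] (R ⧸ I)) × (R ⊗[k] (R ⧸ I))) × (R ⧸ I)) :=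
    ((LS y).coprod DY).prod ((L y).comp (LinearMap.snd k _ _))
  have hA : ∀ u v m, A ((u, v), m) = ((x • u + 1 ⊗ₜ m, x • v), x • m) := by
    intro u v m
    simp [A, LS, L, DX, ι]
  have hB : ∀ u v m, B ((u, v), m) =
      ((y • u - y ⊗ₜ (y • m), y • v + (1 ⊗ₜ m - (y * x) ⊗ₜ m)), y • m) := by
    intro u v m
    simp [B, LS, L, DY, ι, sub_eq_add_neg]
  have hAB : A * B = 1 := by
    apply LinearMap.ext
    rintro ⟨⟨u, v⟩, m⟩
    rw [Module.End.mul_apply, hB, hA]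
    simp [smul_sub, smul_smul, hxy, TensorProduct.smul_tmul', ← mul_assoc]
  obtain ⟨ρ, hρx, hρy⟩ := hlift A B hAB
  have key : ∀ a : R, ∀ u v m, (ρ a ((u, v), m)).2 = a • m ∧
      ρ a ((u, v), 0) = ((a • u, a • v), 0) ∧
      ((G1 (ρ a ((u, v), m)).1.1 : I) : R) + (G2 (ρ a ((u, v), m)).1.2 : I) + t (ρ a ((u, v), m)).2
        = a * ((G1 u : I) + (G2 v : I) + t m) := by
    apply ind
    · intro c u v m
      rw [AlgHom.commutes]
      simp only [Module.algebraMap_end_apply, algebraMap_smul, Prod.smul_mk, smul_zero, true_and]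
      rw [← algebraMap_smul R c u, ← algebraMap_smul R c v, map_smul, map_smul, map_smul]
      simp [mul_add, Algebra.smul_def]
    · intro u v m
      rw [hρx, hA, hA]
      refine ⟨rfl, by simp, ?_⟩
      simp [hG1, δ, mul_add]
      abel
    · intro u v m
      rw [hρy, hB, hB]
      refine ⟨rfl, by simp, ?_⟩
      simp [hG1, hG2, δ, mul_add, mul_sub, smul_smul, hxy, hxy2, mul_assoc]
      abel
    · intro a b ha hb u v m
      obtain ⟨a1, a2, a3⟩ := ha u v m
      obtain ⟨b1, b2, b3⟩ := hb u v m
      refine ⟨by simp [a1, b1, add_smul], by simp [a2, b2, add_smul], ?_⟩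
      rw [add_mul, ← a3, ← b3]
      simp
      abel
    · intro a b ha hb u v m
      obtain ⟨b1, b2, b3⟩ := hb u v m
      obtain ⟨a1, a2, a3⟩ := ha (ρ b ((u, v), m)).1.1 (ρ b ((u, v), m)).1.2 (ρ b ((u, v), m)).2
      refine ⟨?_, ?_, ?_⟩
      · rw [map_mul, Module.End.mul_apply, mul_smul, ← b1]
        exact a1
      · rw [map_mul, Module.End.mul_apply, b2, (ha _ _ 0).2.1, mul_smul, mul_smul]
      · rw [map_mul, Module.End.mul_apply, mul_assoc, ← b3, ← a3]
  have hI : ∀ a : I, (a : R) • (I.mkQ 1) = 0 := by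
    intro a
    rw [← map_smul, smul_eq_mul, mul_one]
    exact (Submodule.Quotient.mk_eq_zero I).2 a.2
  have hI2 : ∀ a : I, ρ (a : R) ((0, 0), I.mkQ 1) = ((ρ (a : R) ((0, 0), I.mkQ 1)).1, 0) := by
    intro a
    refine Prod.ext rfl ?_
    rw [(key a 0 0 (I.mkQ 1)).1, hI]
  let f : I →ₗ[R] ((R ⊗[k] (R ⧸ I)) × (R ⊗[k] (R ⧸ I))) × R :=
    { toFun := fun a => ((ρ (a : R) ((0, 0), I.mkQ 1)).1, (a : R))
      map_add' := fun a b => by simp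
      map_smul' := fun b a => by
        refine Prod.ext ?_ (by simp)
        change (ρ (b * (a : R)) ((0, 0), I.mkQ 1)).1 = b • (ρ (a : R) ((0, 0), I.mkQ 1)).1
        rw [map_mul, Module.End.mul_apply, hI2]
        exact congrArg Prod.fst (key b _ _ 0).2.1 }
  have hc : 1 - t (I.mkQ 1) ∈ I := by
    apply hmem
    rw [map_sub, ht', sub_self]
  let g : ((R ⊗[k] (R ⧸ I)) × (R ⊗[k] (R ⧸ I))) × R →ₗ[R] I :=
    (G1.coprod G2).coprod (LinearMap.toSpanSingleton R I ⟨1 - t (I.mkQ 1), hc⟩)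
  have : Module.Projective R (((R ⊗[k] (R ⧸ I)) × (R ⊗[k] (R ⧸ I))) × R) := inferInstance
  refine Module.Projective.of_split f g ?_
  ext a
  have h3 := (key (a : R) 0 0 (I.mkQ 1)).2.2
  rw [(key (a : R) 0 0 (I.mkQ 1)).1, hI a] at h3
  simp only [map_zero, add_zero, ZeroMemClass.coe_zero, zero_add] at h3
  change ((G1 (ρ (a : R) ((0, 0), I.mkQ 1)).1.1 : I) : R) + (G2 (ρ (a : R) ((0, 0), I.mkQ 1)).1.2 : I)
    + (a : R) * (1 - t (I.mkQ 1)) = a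
  have h4 : ((0 : R ⊗[k] (R ⧸ I)), (0 : R ⊗[k] (R ⧸ I))) = 0 := rfl
  try simp only [h4] at h3 ⊢
  rw [h3, mul_sub, mul_one, add_sub_cancel]

/-- The Jacobson algebra is left hereditary: every left ideal is projective
as a left module. -/
theorem jacobson_left_hereditary (I : Submodule (Jacobson K) (Jacobson K)) :
    Module.Projective (Jacobson K) I := by
  have hrel := RingQuot.mkAlgHom_rel K (JRel.rel (K := K))
  rw [map_mul, map_one] at hrel
  refine hereditary_aux (k := K) (RingQuot.mkAlgHom K (JRel K) (FreeAlgebra.ι K 0))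
    (RingQuot.mkAlgHom K (JRel K) (FreeAlgebra.ι K 1)) hrel ?_ I ?_
  · intro P hc hx hy hadd hmul a
    obtain ⟨a, rfl⟩ := RingQuot.mkAlgHom_surjective K (JRel K) a
    induction a using FreeAlgebra.induction with
    | grade0 r => rw [AlgHom.commutes]; exact hc r
    | grade1 i => fin_cases i <;> assumption
    | mul a b ha hb => rw [map_mul]; exact hmul _ _ ha hb
    | add a b ha hb => rw [map_add]; exact hadd _ _ ha hb
  · intro a b hab
    refine ⟨RingQuot.liftAlgHom K ⟨FreeAlgebra.lift K ![a, b], ?_⟩, ?_, ?_⟩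
    · rintro _ _ ⟨⟩
      simp [hab]
    · simp
    · simp
end
end

section
/- For every f ∈ F, the quotient R ⧸ Submodule.span R {f(c)} is a simple left R-module; equivalently, the left ideal R·f(c) is a maximal left ideal of R. (This quotient is the Chen simple module V^f.) -/
noncomputable section

variable (K : Type*) [Field K]

/-- The loop `c = Y²X`. -/
def cJ : Jacobson K := Yg K ^ 2 * Xg K

/-- `F` is the set of irreducible polynomials `f ∈ K[x]` with `f(0) = -1`. -/
def FSet : Set (Polynomial K) := {f | Irreducible f ∧ f.eval 0 = -1}

theorem ring_aux1 {A : Type*} [Ring A] (k e y : A) :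
    y = k * (1 - e) + y * e + (y - k) * (1 - e) := by noncomm_ring

theorem ring_aux2 {A : Type*} [Ring A] (x r d k g : A) :
    x * r - (d + k * g) = x * r - (d + k * x) + k * (x - g) := by noncomm_ring

theorem ring_aux3 {A : Type*} [Ring A] (x d : A) :
    x - d = -(d + x * (-1)) := by noncomm_ring

theorem XY_assoc (a : Jacobson K) : Xg K * (Yg K * a) = a := by
  rw [← mul_assoc, XY_one, one_mul]

open Polynomial in
theorem e_mul_aeval (p : Polynomial K) :
    (1 - Yg K * Xg K) * aeval (cJ K) p = algebraMap K _ (p.eval 0) * (1 - Yg K * Xg K) := by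
  have h0 : (1 - Yg K * Xg K) * cJ K = 0 := by
    simp [cJ, sub_mul, pow_two, mul_assoc, XY_assoc]
  conv_lhs => rw [← p.divX_mul_X_add]
  rw [← coeff_zero_eq_eval_zero, X_mul.symm, map_add, map_mul, aeval_X, aeval_C, mul_add,
    ← mul_assoc, h0, zero_mul, zero_add, Algebra.commutes]

theorem c_pow (n : ℕ) : cJ K ^ (n + 1) = Yg K ^ (n + 1) * (Yg K * Xg K) := by
  induction n with
  | zero => simp [cJ, pow_two, mul_assoc]
  | succ n ih =>
    rw [pow_succ, ih, pow_succ (Yg K) (n + 1)]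
    simp [cJ, pow_two, mul_assoc, XY_assoc]

open Polynomial in
theorem aeval_c (p : Polynomial K) :
    aeval (cJ K) p = algebraMap K _ (p.eval 0) * (1 - Yg K * Xg K)
      + aeval (Yg K) p * (Yg K * Xg K) := by
  induction p using Polynomial.induction_on' with
  | add p q hp hq => simp only [map_add, hp, hq, eval_add, add_mul]; abel
  | monomial n a =>
    cases n with
    | zero => simp [← mul_add]
    | succ n => simp [aeval_monomial, c_pow, mul_assoc]

section
variable {K}
variable (f : Polynomial K)

/-- The left ideal. -/
abbrev II : Submodule (Jacobson K) (Jacobson K) :=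
  Submodule.span (Jacobson K) {Polynomial.aeval (cJ K) f}


open Polynomial

theorem e_mem (hf : f ∈ FSet K) : 1 - Yg K * Xg K ∈ II f := by
  have h : (1 - Yg K * Xg K) • aeval (cJ K) f ∈ II f :=
    Submodule.smul_mem _ _ (Submodule.mem_span_singleton_self _)
  rw [smul_eq_mul, e_mul_aeval, hf.2] at h
  have h2 := Submodule.smul_mem _ (algebraMap K (Jacobson K) (-1)) h
  rw [smul_eq_mul, ← mul_assoc, ← map_mul] at h2
  simpa using h2

theorem fY_mem (hf : f ∈ FSet K) : aeval (Yg K) f ∈ II f := by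
  have h1 : aeval (cJ K) f ∈ II f := Submodule.mem_span_singleton_self _
  have h2 := Submodule.smul_mem _ (aeval (Yg K) f - algebraMap K _ (f.eval 0)) (e_mem f hf)
  have h3 := add_mem h1 h2
  convert h3 using 1
  rw [aeval_c, smul_eq_mul]
  exact ring_aux1 _ _ _

theorem X_mem (hf : f ∈ FSet K) : Xg K - aeval (Yg K) f.divX ∈ II f := by
  have h := neg_mem (Submodule.smul_mem _ (Xg K) (fY_mem f hf))
  convert h using 1
  conv_rhs => rw [← f.divX_mul_X_add]
  rw [← X_mul, map_add, map_mul, aeval_X, aeval_C, coeff_zero_eq_eval_zero, hf.2, smul_eq_mul,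
    mul_add, XY_assoc, map_neg, map_one]
  exact ring_aux3 _ _

theorem rep_mul (hf : f ∈ FSet K) (a : FreeAlgebra K (Fin 2)) : ∀ r : Jacobson K,
    (∃ p : K[X], r - aeval (Yg K) p ∈ II f) →
    ∃ p : K[X], RingQuot.mkAlgHom K (JRel K) a * r - aeval (Yg K) p ∈ II f := by
  induction a using FreeAlgebra.induction with
  | grade0 k =>
    rintro r ⟨p, hp⟩
    refine ⟨C k * p, ?_⟩
    have := Submodule.smul_mem _ (algebraMap K (Jacobson K) k) hp
    simpa [mul_sub] using this
  | grade1 i =>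
    rintro r ⟨p, hp⟩
    fin_cases i
    · refine ⟨p.divX + C (p.coeff 0) * f.divX, ?_⟩
      have h1 := Submodule.smul_mem _ (Xg K) hp
      have h2 := Submodule.smul_mem _ (algebraMap K (Jacobson K) (p.coeff 0)) (X_mem f hf)
      have h3 := add_mem h1 h2
      have h4 : Xg K * aeval (Yg K) p
          = aeval (Yg K) p.divX + algebraMap K _ (p.coeff 0) * Xg K := by
        conv_lhs => rw [← p.divX_mul_X_add]
        rw [← X_mul, map_add, map_mul, aeval_X, aeval_C, mul_add, XY_assoc, Algebra.commutes]
      convert h3 using 1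
      rw [smul_eq_mul, smul_eq_mul, mul_sub, h4, map_add, map_mul, aeval_C]
      change Xg K * r - _ = _
      exact ring_aux2 _ _ _ _ _
    · refine ⟨X * p, ?_⟩
      have := Submodule.smul_mem _ (Yg K) hp
      rw [map_mul, aeval_X]
      rw [smul_eq_mul, mul_sub] at this
      exact this
  | mul a b ha hb =>
    intro r hr
    rw [map_mul, mul_assoc]
    exact ha _ (hb _ hr)
  | add a b ha hb =>
    intro r hr
    obtain ⟨p, hp⟩ := ha _ hr
    obtain ⟨q, hq⟩ := hb _ hr
    refine ⟨p + q, ?_⟩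
    convert add_mem hp hq using 1
    rw [map_add, map_add, add_mul]
    abel

theorem rep (hf : f ∈ FSet K) (r : Jacobson K) : ∃ p : K[X], r - aeval (Yg K) p ∈ II f := by
  obtain ⟨a, rfl⟩ := RingQuot.mkAlgHom_surjective K (JRel K) r
  simpa using rep_mul f hf a 1 ⟨1, by simp⟩

theorem exists_hom (hf : f ∈ FSet K) [Fact (Irreducible f)] : ∃ φ : Jacobson K →ₐ[K] AdjoinRoot f,
    φ (Xg K) * φ (Yg K) = 1 ∧ φ (Yg K) = AdjoinRoot.root f := by
  have hr : AdjoinRoot.root f ≠ 0 := by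
    intro h0
    have h1 : aeval (AdjoinRoot.root f) f = 0 := by simp
    rw [h0, ← coeff_zero_eq_aeval_zero', coeff_zero_eq_eval_zero, hf.2] at h1
    simp at h1
  refine ⟨RingQuot.liftAlgHom K ⟨FreeAlgebra.lift K
    ![(AdjoinRoot.root f)⁻¹, AdjoinRoot.root f], ?_⟩, ?_, ?_⟩
  · rintro _ _ ⟨⟩
    simp [hr]
  · simp [Xg, Yg, hr]
  · simp [Yg]

theorem coatom (hf : f ∈ FSet K) : IsCoatom (II f) := by
  have : Fact (Irreducible f) := ⟨hf.1⟩
  obtain ⟨φ, hXY, hY⟩ := exists_hom f hf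
  have hφp (p : K[X]) : φ (aeval (Yg K) p) = AdjoinRoot.mk f p := by
    rw [← aeval_algHom_apply, hY, AdjoinRoot.aeval_eq]
  have hc : φ (cJ K) = AdjoinRoot.root f := by
    rw [cJ, map_mul, map_pow, pow_two, mul_assoc, mul_comm (φ (Yg K)) (φ (Xg K)), hXY, mul_one, hY]
  have hker : ∀ r, φ r = 0 ↔ r ∈ II f := by
    intro r
    have hle : ∀ r ∈ II f, φ r = 0 := by
      intro r hr
      obtain ⟨a, rfl⟩ := Submodule.mem_span_singleton.1 hr
      rw [smul_eq_mul, map_mul, ← aeval_algHom_apply, hc, AdjoinRoot.aeval_eq, AdjoinRoot.mk_self,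
        mul_zero]
    refine ⟨fun h => ?_, hle r⟩
    obtain ⟨p, hp⟩ := rep f hf r
    have h1 := hle _ hp
    rw [map_sub, h, zero_sub, neg_eq_zero, hφp, AdjoinRoot.mk_eq_zero] at h1
    obtain ⟨q, rfl⟩ := h1
    have h2 := Submodule.smul_mem _ (aeval (Yg K) q) (fY_mem f hf)
    rw [smul_eq_mul, ← map_mul, mul_comm] at h2
    simpa using add_mem hp h2
  refine ⟨fun h => ?_, fun J hJ => ?_⟩
  · have : φ 1 = 0 := (hker 1).2 (h ▸ Submodule.mem_top)
    simp at this
  · obtain ⟨hle, r, hrJ, hr⟩ := SetLike.lt_iff_le_and_exists.1 hJ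
    have hr0 : φ r ≠ 0 := fun h => hr ((hker r).1 h)
    obtain ⟨p, hp⟩ := AdjoinRoot.mk_surjective (φ r)⁻¹
    have h1 : 1 - aeval (Yg K) p * r ∈ J := hle ((hker _).1 (by
      rw [map_sub, map_one, map_mul, hφp, hp, inv_mul_cancel₀ hr0, sub_self]))
    have h2 := add_mem h1 (J.smul_mem (aeval (Yg K) p) hrJ)
    rw [smul_eq_mul, sub_add_cancel] at h2
    exact (Ideal.eq_top_iff_one J).2 h2

end

/-- For every irreducible `f ∈ K[x]` with `f(0) = -1`, the quotient
`R ⧸ R·f(c)` is a simple left module over the Jacobson algebra `R`;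
equivalently, the left ideal `R·f(c)` is a maximal left ideal. -/
theorem chen_module_simple (f : Polynomial K) (hf : f ∈ FSet K) :
    IsSimpleModule (Jacobson K)
        (Jacobson K ⧸ Submodule.span (Jacobson K) {Polynomial.aeval (cJ K) f}) ∧
      IsCoatom (Submodule.span (Jacobson K) {Polynomial.aeval (cJ K) f}) := by
  exact ⟨isSimpleModule_iff_isCoatom.2 (coatom f hf), coatom f hf⟩
end
end

section
/- For every f ∈ F with n := natDegree f, the left ideal R·f(c) intersects G^f trivially: if x ∈ R lies both in Submodule.span R {f(c)} and in the K-linear span of {c^i : 0 ≤ i ≤ n-1}, then x = 0. -/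
noncomputable section

variable (K : Type*) [Field K]

/-- `G^f`: the `K`-linear span of `{c^i : 0 ≤ i ≤ n - 1}` in the Jacobson algebra,
where `n` is the degree of `f`. -/
def Gf (n : ℕ) : Submodule K (Jacobson K) :=
  Submodule.span K (Set.range fun i : Fin n => cJ K ^ (i : ℕ))

/-- For every irreducible `f ∈ K[x]` with `f(0) = -1` and `n = natDegree f`, the left
ideal `R·f(c)` intersects the `K`-span `G^f` of `{c^i : 0 ≤ i ≤ n-1}` trivially. -/
theorem span_fc_inter_Gf_eq_bot (f : Polynomial K) (hf : f ∈ FSet K) (x : Jacobson K)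
    (hx₁ : x ∈ Submodule.span (Jacobson K) {Polynomial.aeval (cJ K) f})
    (hx₂ : x ∈ Gf K f.natDegree) : x = 0 := by
  obtain ⟨hirr, h0⟩ := hf
  haveI : Fact (Irreducible f) := ⟨hirr⟩
  -- the root of `f` in `K[x]/(f)` is nonzero
  have hroot : AdjoinRoot.root f ≠ 0 := by
    intro h
    have h1 : Polynomial.aeval (AdjoinRoot.root f) f = 0 := by
      rw [AdjoinRoot.aeval_eq, AdjoinRoot.mk_self]
    rw [h, Polynomial.aeval_def, Polynomial.eval₂_at_zero,
      Polynomial.coeff_zero_eq_eval_zero, h0] at h1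
    simp at h1
  -- the representation `X ↦ root⁻¹`, `Y ↦ root`
  let φ₀ : FreeAlgebra K (Fin 2) →ₐ[K] AdjoinRoot f :=
    FreeAlgebra.lift K ![(AdjoinRoot.root f)⁻¹, AdjoinRoot.root f]
  have hφ₀ : ∀ ⦃a b⦄, JRel K a b → φ₀ a = φ₀ b := by
    rintro _ _ ⟨⟩
    simp [φ₀, hroot]
  let φ : Jacobson K →ₐ[K] AdjoinRoot f := RingQuot.liftAlgHom K ⟨φ₀, hφ₀⟩
  have hX : φ (Xg K) = (AdjoinRoot.root f)⁻¹ := by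
    simp [φ, Xg, φ₀]
  have hY : φ (Yg K) = AdjoinRoot.root f := by
    simp [φ, Yg, φ₀]
  have hc : φ (cJ K) = AdjoinRoot.root f := by
    rw [cJ, map_mul, map_pow, hX, hY]
    field_simp
  obtain ⟨r, rfl⟩ := Submodule.mem_span_singleton.mp hx₁
  obtain ⟨a, ha⟩ := (Submodule.mem_span_range_iff_exists_fun K).mp hx₂
  let g : Polynomial K :=
    ∑ i : Fin f.natDegree, Polynomial.C (a i) * Polynomial.X ^ (i : ℕ)
  have hg : Polynomial.aeval (cJ K) g = r • Polynomial.aeval (cJ K) f := by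
    rw [← ha]
    simp [g, Algebra.smul_def]
  have hdeg : g.degree < f.degree := by
    rw [Polynomial.degree_eq_natDegree hirr.ne_zero]
    exact Polynomial.degree_sum_fin_lt a
  have hz : AdjoinRoot.mk f g = 0 := by
    have h2 := congrArg φ hg
    rw [smul_eq_mul, map_mul, ← Polynomial.aeval_algHom_apply,
      ← Polynomial.aeval_algHom_apply, hc, AdjoinRoot.aeval_eq, AdjoinRoot.aeval_eq,
      AdjoinRoot.mk_self, mul_zero] at h2
    exact h2
  have hg0 : g = 0 :=
    Polynomial.eq_zero_of_dvd_of_degree_lt (AdjoinRoot.mk_eq_zero.mp hz) hdeg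
  rw [← hg, hg0, map_zero]
end
end

section
/- For every f ∈ F and every n ≥ 1, the equation f(c)·x = 1 has no solution in the left R-module R ⧸ Submodule.span R {f(c)^n}: for every m ∈ R, the element f(c) * m - 1 does not belong to Submodule.span R {f(c)^n}. -/
noncomputable section

variable (K : Type*) [Field K]

/-- For every irreducible `f ∈ K[x]` with `f(0) = -1` and every `n ≥ 1`, the equation
`f(c) · x = 1` has no solution in `R ⧸ R·f(c)^n`: for every `m ∈ R`, the element
`f(c) * m - 1` does not lie in the left ideal `R·f(c)^n`. -/
theorem no_solution_in_Mn (f : Polynomial K) (hf : f ∈ FSet K) (n : ℕ) (hn : 1 ≤ n)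
    (m : Jacobson K) :
    Polynomial.aeval (cJ K) f * m - 1 ∉
      Submodule.span (Jacobson K) {Polynomial.aeval (cJ K) f ^ n} := by
  obtain ⟨hirr, h0⟩ := hf
  have : Fact (Irreducible f) := ⟨hirr⟩
  have hroot : Polynomial.aeval (AdjoinRoot.root f) f = 0 := by
    rw [AdjoinRoot.aeval_eq, AdjoinRoot.mk_self]
  have hne : AdjoinRoot.root f ≠ 0 := by
    intro h
    rw [h, ← map_zero (algebraMap K (AdjoinRoot f)), Polynomial.aeval_algebraMap_apply] at hroot
    simp [Polynomial.aeval_def] at hroot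
    rw [Polynomial.coeff_zero_eq_eval_zero, h0] at hroot
    simp at hroot
  let φ : Jacobson K →ₐ[K] AdjoinRoot f :=
    RingQuot.liftAlgHom K
      ⟨FreeAlgebra.lift K ![(AdjoinRoot.root f)⁻¹, AdjoinRoot.root f], by
        rintro _ _ ⟨⟩
        simp [hne]⟩
  have hX : φ (Xg K) = (AdjoinRoot.root f)⁻¹ := by
    simp [φ, Xg]
  have hY : φ (Yg K) = AdjoinRoot.root f := by
    simp [φ, Yg]
  have hc : φ (cJ K) = AdjoinRoot.root f := by
    rw [cJ, map_mul, map_pow, hX, hY]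
    field_simp
  have hfc : φ (Polynomial.aeval (cJ K) f) = 0 := by
    rw [← Polynomial.aeval_algHom_apply, hc, hroot]
  intro hmem
  obtain ⟨r, hr⟩ := Submodule.mem_span_singleton.mp hmem
  have h := congrArg φ hr
  rw [smul_eq_mul, map_mul, map_pow, map_sub, map_mul, hfc, map_one,
    zero_pow (by omega)] at h
  simp at h
end
end

section
/- For every f ∈ F and every n ≥ 1, every R-linear map from the left ideal R·w = Submodule.span R {w} to the left R-module R ⧸ Submodule.span R {f(c)^n} is the zero map. (In particular, Hom_R(Rw, V^f) = 0, where V^f = R ⧸ R·f(c).) -/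
noncomputable section

variable (K : Type*) [Field K]

/-- The vertex idempotent `w = 1 - YX`. -/
def wJ : Jacobson K := 1 - Yg K * Xg K

theorem wY_zero : wJ K * Yg K = 0 := by
  unfold wJ
  rw [sub_mul, one_mul, mul_assoc, XY_one, mul_one, sub_self]

theorem ww_eq : wJ K * wJ K = wJ K := by
  conv_lhs => rhs; unfold wJ
  rw [mul_sub, mul_one, ← mul_assoc, wY_zero, zero_mul, sub_zero]

theorem Xc_eq : Xg K * cJ K = Yg K * Xg K := by
  unfold cJ
  rw [pow_two, ← mul_assoc, ← mul_assoc, XY_one, one_mul]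

theorem wX_nil (i : ℕ) : wJ K * Xg K ^ i * cJ K ^ (i + 1) = 0 := by
  induction i with
  | zero =>
    simp only [pow_zero, mul_one, zero_add, pow_one]
    unfold cJ
    rw [pow_two, ← mul_assoc, ← mul_assoc, wY_zero, zero_mul, zero_mul]
  | succ i ih =>
    rw [pow_succ' (cJ K), ← mul_assoc, pow_succ (Xg K), mul_assoc (wJ K), mul_assoc (Xg K ^ i),
      Xc_eq]
    cases i with
    | zero =>
      rw [pow_zero, one_mul, ← mul_assoc, wY_zero, zero_mul, zero_mul]
    | succ j =>
      have : Xg K ^ (j + 1) * (Yg K * Xg K) = Xg K ^ (j + 1) := by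
        rw [pow_succ, mul_assoc, ← mul_assoc (Xg K) (Yg K), XY_one, one_mul]
      rw [this, ih]

/-- The span of the elements `w X^i`. -/
def WXspan : Submodule K (Jacobson K) := Submodule.span K (Set.range fun i : ℕ => wJ K * Xg K ^ i)

theorem WXspan_nil (z : Jacobson K) (hz : z ∈ WXspan K) : ∃ m : ℕ, z * cJ K ^ m = 0 := by
  unfold WXspan at hz
  induction hz using Submodule.span_induction with
  | mem x hx =>
    obtain ⟨i, rfl⟩ := hx
    exact ⟨i + 1, wX_nil K i⟩
  | zero => exact ⟨0, zero_mul _⟩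
  | add x y _ _ hx hy =>
    obtain ⟨a, ha⟩ := hx
    obtain ⟨b, hb⟩ := hy
    refine ⟨a + b, ?_⟩
    rw [add_mul, pow_add, ← mul_assoc, ha, zero_mul, ← pow_add, add_comm a b, pow_add,
      ← mul_assoc, hb, zero_mul, add_zero]
  | smul k x _ hx =>
    obtain ⟨a, ha⟩ := hx
    exact ⟨a, by rw [smul_mul_assoc, ha, smul_zero]⟩

theorem WXspan_X (z : Jacobson K) (hz : z ∈ WXspan K) : z * Xg K ∈ WXspan K := by
  unfold WXspan at hz
  induction hz using Submodule.span_induction with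
  | mem x hx =>
    obtain ⟨i, rfl⟩ := hx
    exact Submodule.subset_span ⟨i + 1, by simp only [pow_succ, mul_assoc]⟩
  | zero => rw [zero_mul]; exact Submodule.zero_mem _
  | add x y _ _ hx hy => rw [add_mul]; exact Submodule.add_mem _ hx hy
  | smul k x _ hx => rw [smul_mul_assoc]; exact Submodule.smul_mem _ _ hx

theorem WXspan_Y (z : Jacobson K) (hz : z ∈ WXspan K) : z * Yg K ∈ WXspan K := by
  unfold WXspan at hz
  induction hz using Submodule.span_induction with
  | mem x hx =>
    obtain ⟨i, rfl⟩ := hx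
    cases i with
    | zero =>
      simp only [pow_zero, mul_one]
      rw [wY_zero]; exact Submodule.zero_mem _
    | succ i =>
      refine Submodule.subset_span ⟨i, ?_⟩
      simp only [pow_succ, mul_assoc, XY_one, mul_one]
  | zero => rw [zero_mul]; exact Submodule.zero_mem _
  | add x y _ _ hx hy => rw [add_mul]; exact Submodule.add_mem _ hx hy
  | smul k x _ hx => rw [smul_mul_assoc]; exact Submodule.smul_mem _ _ hx

theorem WXspan_mul (a : FreeAlgebra K (Fin 2)) :
    ∀ z ∈ WXspan K, z * RingQuot.mkAlgHom K (JRel K) a ∈ WXspan K := by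
  induction a using FreeAlgebra.induction with
  | grade0 r =>
    intro z hz
    rw [AlgHom.commutes, ← Algebra.commutes, ← Algebra.smul_def]
    exact Submodule.smul_mem _ _ hz
  | grade1 i =>
    intro z hz
    fin_cases i
    · exact WXspan_X K z hz
    · exact WXspan_Y K z hz
  | mul a b ha hb =>
    intro z hz
    rw [map_mul, ← mul_assoc]
    exact hb _ (ha _ hz)
  | add a b ha hb =>
    intro z hz
    rw [map_add, mul_add]
    exact Submodule.add_mem _ (ha _ hz) (hb _ hz)

theorem w_mul_nil (r : Jacobson K) : ∃ m : ℕ, wJ K * r * cJ K ^ m = 0 := by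
  obtain ⟨a, rfl⟩ := RingQuot.mkAlgHom_surjective K (JRel K) r
  exact WXspan_nil K _ (WXspan_mul K a _ (Submodule.subset_span ⟨0, by simp⟩))

theorem w_mul_mem (f : Polynomial K) (hf : f ∈ FSet K) (n : ℕ) (r : Jacobson K) :
    wJ K * r ∈ Submodule.span (Jacobson K) {Polynomial.aeval (cJ K) f ^ n} := by
  obtain ⟨m, hm⟩ := w_mul_nil K r
  have hcop : IsCoprime (Polynomial.X : Polynomial K) f := by
    rw [Polynomial.irreducible_X.coprime_iff_not_dvd, Polynomial.X_dvd_iff,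
      Polynomial.coeff_zero_eq_eval_zero, hf.2]
    simp
  obtain ⟨a, b, hab⟩ := hcop.pow (m := m) (n := n)
  have h := congrArg (Polynomial.aeval (cJ K)) hab
  rw [mul_comm a] at h
  simp only [map_add, map_mul, map_pow, Polynomial.aeval_X, map_one] at h
  rw [Submodule.mem_span_singleton]
  refine ⟨wJ K * r * Polynomial.aeval (cJ K) b, ?_⟩
  rw [smul_eq_mul]
  conv_rhs => rw [← mul_one (wJ K * r), ← h, mul_add, ← mul_assoc, hm, zero_mul, zero_add]
  rw [mul_assoc]

/-- For every irreducible `f ∈ K[x]` with `f(0) = -1` and every `n ≥ 1`, every `R`-linear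
map from the left ideal `R·w` to `R ⧸ R·f(c)^n` is zero.  (In particular
`Hom_R(Rw, V^f) = 0`.) -/
theorem hom_Rw_to_Mn_eq_zero (f : Polynomial K) (hf : f ∈ FSet K) (n : ℕ) (hn : 1 ≤ n)
    (φ : (Submodule.span (Jacobson K) {wJ K}) →ₗ[Jacobson K]
      (Jacobson K ⧸ Submodule.span (Jacobson K) {Polynomial.aeval (cJ K) f ^ n})) :
    φ = 0 := by
  have hw : wJ K ∈ Submodule.span (Jacobson K) {wJ K} := Submodule.mem_span_singleton_self _
  have h0 : φ ⟨wJ K, hw⟩ = 0 := by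
    have h1 : φ ⟨wJ K, hw⟩ = wJ K • φ ⟨wJ K, hw⟩ := by
      rw [← map_smul]
      congr 1
      exact Subtype.ext (ww_eq K).symm
    rw [h1]
    obtain ⟨s, hs⟩ := Submodule.Quotient.mk_surjective _ (φ ⟨wJ K, hw⟩)
    rw [← hs, ← Submodule.Quotient.mk_smul, Submodule.Quotient.mk_eq_zero]
    exact w_mul_mem K f hf n s
  ext ⟨x, hx⟩
  obtain ⟨r, rfl⟩ := Submodule.mem_span_singleton.1 hx
  have : (⟨r • wJ K, hx⟩ : Submodule.span (Jacobson K) {wJ K}) = r • ⟨wJ K, hw⟩ := rfl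
  rw [this, map_smul, h0, smul_zero, LinearMap.zero_apply]
end
end

section
/- Let f ∈ F, let g ∈ K[x] be a polynomial not divisible by f, and let n ≥ 1. Then there exists a polynomial β ∈ K[x] such that β(c) * g(c) - 1 ∈ Submodule.span R {f(c)^n}; in particular the coset of g(c) generates the cyclic left R-module R ⧸ Submodule.span R {f(c)^n}. -/
noncomputable section

variable (K : Type*) [Field K]

/-- Let `f` be irreducible with `f(0) = -1`, let `g ∈ K[x]` be not divisible by `f`, and
let `n ≥ 1`.  Then there is a polynomial `β ∈ K[x]` with
`β(c) * g(c) ∈ 1 + R·f(c)^n`; in particular the coset of `g(c)` generates the cyclic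
left module `R ⧸ R·f(c)^n`. -/
theorem coprime_coset_generates (f : Polynomial K) (hf : f ∈ FSet K) (g : Polynomial K)
    (hg : ¬ f ∣ g) (n : ℕ) (hn : 1 ≤ n) :
    (∃ β : Polynomial K,
        Polynomial.aeval (cJ K) β * Polynomial.aeval (cJ K) g - 1 ∈
          Submodule.span (Jacobson K) {Polynomial.aeval (cJ K) f ^ n}) ∧
      Submodule.span (Jacobson K)
          {(Submodule.Quotient.mk (Polynomial.aeval (cJ K) g) :
            Jacobson K ⧸ Submodule.span (Jacobson K) {Polynomial.aeval (cJ K) f ^ n})} =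
        ⊤ := by
  have hc : IsCoprime (f ^ n) g := ((hf.1.coprime_iff_not_dvd).2 hg).pow_left
  obtain ⟨a, b, hab⟩ := hc
  have key : Polynomial.aeval (cJ K) b * Polynomial.aeval (cJ K) g - 1 ∈
      Submodule.span (Jacobson K) {Polynomial.aeval (cJ K) f ^ n} := by
    rw [Submodule.mem_span_singleton]
    refine ⟨Polynomial.aeval (cJ K) (-a), ?_⟩
    have hab' : (-a) * f ^ n + 1 = b * g := by rw [← hab]; ring
    have h := congrArg (Polynomial.aeval (cJ K)) hab'
    rw [map_add, map_mul, map_mul, map_pow, map_one] at h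
    rw [smul_eq_mul]
    exact eq_sub_of_add_eq h
  refine ⟨⟨b, key⟩, ?_⟩
  rw [eq_top_iff]
  rintro x -
  obtain ⟨r, rfl⟩ := Submodule.Quotient.mk_surjective _ x
  rw [Submodule.mem_span_singleton]
  refine ⟨r * Polynomial.aeval (cJ K) b, ?_⟩
  rw [← Submodule.Quotient.mk_smul, Submodule.Quotient.eq]
  have h2 := Submodule.smul_mem _ r key
  rw [smul_eq_mul, mul_sub, mul_one, ← mul_assoc] at h2
  exact h2
end
end

section
/- For every f ∈ F, the equation f(c)·x = d has no solution in R·w: there is no x ∈ Submodule.span R {w} with f(c) * x = d. Consequently, the left R-module Submodule.span R {w} is not injective. -/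
noncomputable section

variable (K : Type*) [Field K]

/-- The exit edge `d = Y - Y²X`. -/
def dJ : Jacobson K := Yg K - Yg K ^ 2 * Xg K

/-- Division by the variable on power series. -/
def dvX : Module.End K (PowerSeries K) where
  toFun g := PowerSeries.mk fun n => PowerSeries.coeff (n + 1) g
  map_add' a b := by ext n; simp
  map_smul' a b := by ext n; simp

/-- Multiplication by the variable on power series. -/
def mlX : Module.End K (PowerSeries K) where
  toFun g := PowerSeries.X * g
  map_add' a b := by ring
  map_smul' a b := by simp

theorem dvX_X_mul (g : PowerSeries K) : dvX K (PowerSeries.X * g) = g := by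
  ext n
  simp [dvX, PowerSeries.coeff_succ_X_mul]

theorem dvX_C (a : K) : dvX K (PowerSeries.C a) = 0 := by
  ext n
  simp [dvX, PowerSeries.coeff_C]

/-- The action of the Jacobson algebra on power series. -/
def rhoJ : Jacobson K →ₐ[K] Module.End K (PowerSeries K) :=
  RingQuot.liftAlgHom K ⟨FreeAlgebra.lift K ![dvX K, mlX K], by
    intro a b h
    cases h
    ext1 g
    simp [Module.End.mul_apply, mlX, dvX_X_mul]⟩

theorem rhoJ_X : rhoJ K (Xg K) = dvX K := by
  simp [rhoJ, Xg]

theorem rhoJ_Y : rhoJ K (Yg K) = mlX K := by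
  simp [rhoJ, Yg]

theorem rhoJ_c_X (g : PowerSeries K) :
    rhoJ K (cJ K) (PowerSeries.X * g) = PowerSeries.X * (PowerSeries.X * g) := by
  simp only [cJ, map_mul, map_pow, rhoJ_X, rhoJ_Y, Module.End.mul_apply, pow_two, dvX_X_mul]
  rfl

theorem rhoJ_c_C (a : K) : rhoJ K (cJ K) (PowerSeries.C a) = 0 := by
  simp only [cJ, map_mul, map_pow, rhoJ_X, rhoJ_Y, Module.End.mul_apply, pow_two, dvX_C, map_zero]

theorem rhoJ_f_X (f : Polynomial K) (g : PowerSeries K) :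
    rhoJ K (Polynomial.aeval (cJ K) f) (PowerSeries.X * g)
      = PowerSeries.X * ((f : PowerSeries K) * g) := by
  induction f using Polynomial.induction_on' generalizing g with
  | add p q hp hq => simp only [map_add, LinearMap.add_apply, hp, hq, Polynomial.coe_add]; ring
  | monomial n a =>
    rw [Polynomial.aeval_monomial, map_mul (rhoJ K), AlgHom.commutes, map_pow, Module.End.mul_apply,
      Module.algebraMap_end_apply]
    have : ∀ g : PowerSeries K, (rhoJ K (cJ K) ^ n) (PowerSeries.X * g)
        = PowerSeries.X * (PowerSeries.X ^ n * g) := by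
      induction n with
      | zero => intro g; simp
      | succ n ih =>
        intro g
        rw [pow_succ, Module.End.mul_apply, rhoJ_c_X, ih]; ring
    rw [this, ← Polynomial.C_mul_X_pow_eq_monomial, Polynomial.coe_mul, Polynomial.coe_C,
      Polynomial.coe_pow, Polynomial.coe_X, PowerSeries.smul_eq_C_mul]
    ring

theorem rhoJ_f_C (f : Polynomial K) (a : K) :
    rhoJ K (Polynomial.aeval (cJ K) f) (PowerSeries.C a)
      = PowerSeries.C (f.eval 0 * a) := by
  induction f using Polynomial.induction_on' with
  | add p q hp hq => simp only [map_add, LinearMap.add_apply, hp, hq, Polynomial.eval_add, add_mul]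
  | monomial n b =>
    rw [Polynomial.aeval_monomial, map_mul (rhoJ K), AlgHom.commutes, map_pow, Module.End.mul_apply,
      Module.algebraMap_end_apply]
    cases n with
    | zero => simp [PowerSeries.smul_eq_C_mul]
    | succ n => rw [pow_succ, Module.End.mul_apply, rhoJ_c_C]; simp

theorem X_w : Xg K * wJ K = 0 := by
  rw [wJ, mul_sub, ← mul_assoc, XY_one]; simp

theorem d_eq : dJ K = Yg K * wJ K := by
  rw [dJ, wJ, mul_sub, ← mul_assoc, pow_two, mul_one]

theorem key (s : Jacobson K) : ∀ p : Polynomial K, ∃ q : Polynomial K,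
    s * (Polynomial.aeval (Yg K) p * wJ K) = Polynomial.aeval (Yg K) q * wJ K ∧
    rhoJ K s (p : PowerSeries K) = (q : PowerSeries K) := by
  obtain ⟨s, rfl⟩ := RingQuot.mkAlgHom_surjective K (JRel K) s
  induction s using FreeAlgebra.induction with
  | grade0 r =>
    intro p
    refine ⟨Polynomial.C r * p, ?_, ?_⟩
    · rw [AlgHom.commutes, map_mul, Polynomial.aeval_C, mul_assoc]
    · rw [AlgHom.commutes, AlgHom.commutes, Module.algebraMap_end_apply, Polynomial.coe_mul,
        Polynomial.coe_C, PowerSeries.smul_eq_C_mul]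
  | grade1 i =>
    intro p
    fin_cases i
    · change ∃ q : Polynomial K,
        Xg K * (Polynomial.aeval (Yg K) p * wJ K) = Polynomial.aeval (Yg K) q * wJ K ∧
        rhoJ K (Xg K) (p : PowerSeries K) = (q : PowerSeries K)
      rw [rhoJ_X]
      refine ⟨p.divX, ?_, ?_⟩
      · conv_lhs => rw [← Polynomial.X_mul_divX_add p]
        rw [map_add, map_mul, Polynomial.aeval_X, Polynomial.aeval_C, add_mul, mul_add,
          mul_assoc, ← mul_assoc, XY_one, one_mul, ← mul_assoc, ← Algebra.commutes, mul_assoc,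
          X_w, mul_zero, add_zero]
      · ext n
        simp [dvX, Polynomial.coeff_divX]
    · change ∃ q : Polynomial K,
        Yg K * (Polynomial.aeval (Yg K) p * wJ K) = Polynomial.aeval (Yg K) q * wJ K ∧
        rhoJ K (Yg K) (p : PowerSeries K) = (q : PowerSeries K)
      rw [rhoJ_Y]
      refine ⟨Polynomial.X * p, ?_, ?_⟩
      · rw [map_mul, Polynomial.aeval_X, mul_assoc]
      · simp [mlX]
  | mul a b ha hb =>
    intro p
    obtain ⟨q, h1, h2⟩ := hb p
    obtain ⟨q', h3, h4⟩ := ha q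
    refine ⟨q', ?_, ?_⟩
    · rw [map_mul, mul_assoc, h1, h3]
    · rw [map_mul, map_mul, Module.End.mul_apply, h2, h4]
  | add a b ha hb =>
    intro p
    obtain ⟨q, h1, h2⟩ := hb p
    obtain ⟨q', h3, h4⟩ := ha p
    refine ⟨q' + q, ?_, ?_⟩
    · rw [map_add, map_add, add_mul, add_mul, h1, h3]
    · rw [map_add, map_add, LinearMap.add_apply, h2, h4, Polynomial.coe_add]

theorem rhoJ_d : rhoJ K (dJ K) 1 = PowerSeries.X := by
  have h1 : dvX K 1 = 0 := by simpa using dvX_C K 1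
  rw [d_eq, wJ]
  simp [rhoJ_X, rhoJ_Y, h1, Module.End.mul_apply, mlX]

theorem no_sol (f : Polynomial K) (hf : f ∈ FSet K) (x : Jacobson K) :
    Polynomial.aeval (cJ K) f * x ≠ dJ K := by
  intro h
  have h1 := congrArg (fun r => rhoJ K r 1) h
  simp only [map_mul, Module.End.mul_apply, rhoJ_d] at h1
  obtain ⟨q, -, h2⟩ := key K x 1
  rw [Polynomial.coe_one] at h2
  rw [h2, ← Polynomial.X_mul_divX_add q, Polynomial.coe_add, Polynomial.coe_mul,
    Polynomial.coe_X, Polynomial.coe_C, map_add, rhoJ_f_X, rhoJ_f_C] at h1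
  have h3 := congrArg (dvX K) h1
  rw [map_add, dvX_X_mul, dvX_C, add_zero] at h3
  rw [← mul_one (PowerSeries.X : PowerSeries K), dvX_X_mul] at h3
  have h4 : f * q.divX = 1 := by
    apply Polynomial.coe_injective K
    simpa using h3
  exact hf.1.not_isUnit (IsUnit.of_mul_eq_one _ h4)

theorem ker_le (f : Polynomial K) (hf : f ∈ FSet K) (r : Jacobson K)
    (h : r * Polynomial.aeval (cJ K) f = 0) : r * dJ K = 0 := by
  have h0 : PowerSeries.constantCoeff (f : PowerSeries K) ≠ 0 := by
    have := hf.2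
    rw [← Polynomial.coeff_zero_eq_eval_zero] at this
    simp [this]
  obtain ⟨q, h1, h2⟩ := key K r Polynomial.X
  have h3 := congrArg
    (fun r => rhoJ K r (PowerSeries.X * (f : PowerSeries K)⁻¹)) h
  simp only [map_mul, Module.End.mul_apply, rhoJ_f_X, PowerSeries.mul_inv_cancel _ h0, mul_one,
    map_zero, LinearMap.zero_apply] at h3
  rw [Polynomial.coe_X, h3] at h2
  have h4 : q = 0 := by
    apply Polynomial.coe_injective K
    simpa using h2.symm
  rw [d_eq]
  simpa [h4] using h1

theorem gen_noninj {R : Type*} [Ring R] (I : Submodule R R) (a d : R) (hd : d ∈ I)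
    (hk : ∀ r, r * a = 0 → r * d = 0) (hn : ∀ x, a * x ≠ d) (hinj : Module.Injective R I) :
    False := by
  let φ := LinearMap.toSpanSingleton R R a
  let ψ := LinearMap.toSpanSingleton R I ⟨d, hd⟩
  have hle : LinearMap.ker φ ≤ LinearMap.ker ψ := by
    intro r hr
    rw [LinearMap.mem_ker] at hr ⊢
    exact Subtype.ext (hk r hr)
  obtain ⟨h, hh⟩ := hinj.out ((LinearMap.ker φ).liftQ φ le_rfl)
    (LinearMap.ker_eq_bot.mp (Submodule.ker_liftQ_eq_bot _ _ _ le_rfl))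
    ((LinearMap.ker φ).liftQ ψ hle)
  have h1 := hh (Submodule.Quotient.mk 1)
  rw [Submodule.liftQ_apply, Submodule.liftQ_apply] at h1
  have h2 : h (a • (1 : R)) = ⟨d, hd⟩ := by
    simpa [φ, ψ] using h1
  rw [map_smul] at h2
  exact hn _ (congrArg Subtype.val h2)


/-- For every irreducible `f ∈ K[x]` with `f(0) = -1`, the equation `f(c)·x = d` has no
solution in the left ideal `R·w`; consequently the left module `R·w` is not injective. -/
theorem Rw_not_injective (f : Polynomial K) (hf : f ∈ FSet K) :
    (¬∃ x ∈ Submodule.span (Jacobson K) {wJ K},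
        Polynomial.aeval (cJ K) f * x = dJ K) ∧
      ¬ Module.Injective (Jacobson K) (Submodule.span (Jacobson K) {wJ K}) := by
  refine ⟨fun ⟨x, _, hx⟩ => no_sol K f hf x hx, fun hinj => ?_⟩
  have hd : dJ K ∈ Submodule.span (Jacobson K) {wJ K} := by
    rw [d_eq]
    exact Submodule.smul_mem _ (Yg K) (Submodule.mem_span_singleton_self _)
  exact gen_noninj _ _ _ hd (ker_le K f hf) (no_sol K f hf) hinj
end
end
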